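/- Let (G,+) be a semimodule over a discrete semiring (R,+,·). If S ⊆ G is syndetic in (G,+), then S is a van der Waerden set: for every finite set F ⊆ G there exists a syndetic subset D_F of (R,+) such that for each d ∈ D_F there is some a ∈ G with a + d•F ⊆ S, where a + d•F = {a + d•g : g ∈ F}. -/

import Mathlib

/-- A subset `N` of `(S,+)` is syndetic if there is a finite set `K ⊆ S` such that
`(K + g) ∩ N ≠ ∅` for every `g ∈ S`. -/
def Syndetic {S : Type*} [Add S] (N : Set S) : Prop :=
  ∃ K : Finset S, ∀ g : S, ∃ k ∈ K, k + g ∈ N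

/-- If a subset `N` of a commutative additive monoid is not syndetic, then its complement contains
all nonempty subset sums of arbitrarily long finite families. -/
theorem exists_subset_sums_notMem_of_not_syndetic {M ι : Type*} [AddCommMonoid M] {N : Set M}
    (hN : ¬ Syndetic N) (s : Finset ι) :
    ∃ r : ι → M, ∀ t ⊆ s, t.Nonempty → ∑ i ∈ t, r i ∉ N := by
  classical
  induction s using Finset.induction_on with
  | empty =>
    exact ⟨0, fun t ht hne => absurd (Finset.subset_empty.mp ht) hne.ne_empty⟩
  | insert j s hj ih =>
    obtain ⟨r, hr⟩ := ih
    simp only [Syndetic, not_exists, not_forall, not_and] at hN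
    obtain ⟨x, hx⟩ := hN (s.powerset.image fun t => ∑ i ∈ t, r i)
    have hsum (t : Finset ι) (ht : t ⊆ s) :
        ∑ i ∈ t, Function.update r j x i = ∑ i ∈ t, r i :=
      Finset.sum_congr rfl fun i hi =>
        Function.update_of_ne (ne_of_mem_of_not_mem (ht hi) hj) _ _
    refine ⟨Function.update r j x, fun t ht hne => ?_⟩
    by_cases hjt : j ∈ t
    · have hts : t.erase j ⊆ s := Finset.subset_insert_iff.mp ht
      rw [← Finset.sum_erase_add _ _ hjt, hsum _ hts, Function.update_self]
      exact hx _ (Finset.mem_image_of_mem _ (Finset.mem_powerset.mpr hts))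
    · have hts : t ⊆ s := (Finset.subset_insert_iff_of_notMem hjt).mp ht
      rw [hsum t hts]
      exact hr t hts hne

/-- Along a combinatorial line in a module, a weighted sum of coordinates is a constant plus the
sum of the weights of the active coordinates times the parameter. -/
theorem Combinatorics.Line.exists_sum_smul_eq {R G ι : Type*} [Semiring R] [AddCommMonoid G]
    [Module R G] [Fintype ι] {F : Finset G} (l : Combinatorics.Line F ι) (r : ι → R) :
    ∃ (a : G) (t : Finset ι), t.Nonempty ∧
      ∀ g : F, ∑ i, r i • (l g i : G) = a + (∑ i ∈ t, r i) • (g : G) := by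
  classical
  obtain ⟨j, hj⟩ := l.proper
  refine ⟨∑ i with l.idxFun i ≠ none, r i • ((l.idxFun i).elim 0 (fun g => (g : G))),
    Finset.univ.filter fun i => l.idxFun i = none, ⟨j, by simpa using hj⟩, fun g => ?_⟩
  rw [Finset.sum_smul, add_comm,
    ← Finset.sum_filter_add_sum_filter_not Finset.univ fun i => l.idxFun i = none]
  congr 1
  · refine Finset.sum_congr rfl fun i hi => ?_
    rw [l.apply_none g i (Finset.mem_filter.mp hi).2]
  · refine Finset.sum_congr rfl fun i hi => ?_
    obtain ⟨y, hy⟩ := Option.ne_none_iff_exists'.mp (Finset.mem_filter.mp hi).2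
    rw [l.apply_some hy, hy, Option.elim_some]

/-- Syndetic subsets of a semimodule are van der Waerden sets: if `S` is syndetic in a
semimodule `(G,+)` over a discrete semiring `(R,+,·)`, then for every finite `F ⊆ G`
there is a syndetic subset `D_F` of `(R,+)` such that for each `d ∈ D_F` there is some
`a ∈ G` with `a + d • F ⊆ S`. -/
theorem syndetic_is_vdW_set {R G : Type*} [Semiring R] [AddCommMonoid G] [Module R G]
    (S : Set G) (hS : Syndetic S) :
    ∀ F : Finset G, ∃ D : Set R, Syndetic D ∧
      ∀ d ∈ D, ∃ a : G, ∀ g ∈ F, a + d • g ∈ S := by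
  intro F
  refine ⟨{d | ∃ a : G, ∀ g ∈ F, a + d • g ∈ S}, ?_, fun d hd => hd⟩
  by_contra hD
  obtain ⟨K, hK⟩ := hS
  choose c hcK hcS using hK
  obtain ⟨ι, _, hι⟩ := Combinatorics.Line.exists_mono_in_high_dimension F K
  obtain ⟨r, hr⟩ := exists_subset_sums_notMem_of_not_syndetic hD (Finset.univ : Finset ι)
  obtain ⟨l, k, hk⟩ := hι fun v => ⟨c (∑ i, r i • (v i : G)), hcK _⟩
  obtain ⟨a, t, ht, hsum⟩ := l.exists_sum_smul_eq r
  refine hr t (Finset.subset_univ t) ht ⟨k + a, fun g hg => ?_⟩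
  have hkg : c (∑ i, r i • (l ⟨g, hg⟩ i : G)) = k := congrArg Subtype.val (hk ⟨g, hg⟩)
  rw [add_assoc, ← hsum ⟨g, hg⟩, ← hkg]
  exact hcS _
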